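/- arXiv:1610.06246 — 4 statements merged into one kernel-verified Lean document; each statement's English description precedes it below -/
import Mathlib

section
/- On the free ℤ[v,v⁻¹]-module with basis {h_x}_{x ∈ W} there exists exactly one associative, ℤ[v,v⁻¹]-bilinear multiplication with unit h_e (e the identity of W) such that for all s ∈ S and x ∈ W: h_s h_x = h_{sx} if ℓ(sx) > ℓ(x), and h_s h_x = (v⁻¹ − v) h_x + h_{sx} if ℓ(sx) < ℓ(x). -/
open LaurentPolynomial

/-- The standard basis element `h_x` of the free `ℤ[v,v⁻¹]`-module on a group `W`. -/
noncomputable def heckeStd {W : Type} [Group W] (x : W) : W →₀ LaurentPolynomial ℤ :=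
  Finsupp.single x 1

namespace HeckeAux

section cox
variable {B W : Type} [Group W] {M : CoxeterMatrix B} (cs : CoxeterSystem M W)

theorem left_induction {P : W → Prop} (h1 : P 1)
    (hs : ∀ i x, cs.length x < cs.length (cs.simple i * x) → P x → P (cs.simple i * x)) :
    ∀ w, P w := by
  intro w
  induction hn : cs.length w using Nat.strong_induction_on generalizing w with
  | _ n ih =>
    by_cases hw : w = 1
    · exact hw ▸ h1
    · obtain ⟨i, hi⟩ := cs.exists_leftDescent_of_ne_one hw
      have hi' : cs.length (cs.simple i * w) < cs.length w := hi
      have := hs i (cs.simple i * w) (by simpa using hi') (ih _ (hn ▸ hi') _ rfl)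
      simpa using this

theorem right_induction {P : W → Prop} (h1 : P 1)
    (hs : ∀ i x, cs.length x < cs.length (x * cs.simple i) → P x → P (x * cs.simple i)) :
    ∀ w, P w := by
  intro w
  induction hn : cs.length w using Nat.strong_induction_on generalizing w with
  | _ n ih =>
    by_cases hw : w = 1
    · exact hw ▸ h1
    · obtain ⟨i, hi⟩ := cs.exists_rightDescent_of_ne_one hw
      have hi' : cs.length (w * cs.simple i) < cs.length w := hi
      have := hs i (w * cs.simple i) (by simpa using hi') (ih _ (hn ▸ hi') _ rfl)
      simpa using this

open Classical in
noncomputable def f (i : B) : Equiv.Perm (W × ZMod 2) where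
  toFun p := (cs.simple i * p.1 * cs.simple i, p.2 + if p.1 = cs.simple i then 1 else 0)
  invFun p := (cs.simple i * p.1 * cs.simple i, p.2 + if p.1 = cs.simple i then 1 else 0)
  left_inv := by
    rintro ⟨t, e⟩
    have h : cs.simple i * t * cs.simple i = cs.simple i ↔ t = cs.simple i := by
      constructor
      · intro h
        have := congrArg (fun z => cs.simple i * z * cs.simple i) h
        simpa [mul_assoc] using this
      · rintro rfl; simp
    simp only [h]
    ext
    · simp [mul_assoc]
    · simp only [add_assoc, CharTwo.add_self_eq_zero, add_zero]
  right_inv := by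
    rintro ⟨t, e⟩
    have h : cs.simple i * t * cs.simple i = cs.simple i ↔ t = cs.simple i := by
      constructor
      · intro h
        have := congrArg (fun z => cs.simple i * z * cs.simple i) h
        simpa [mul_assoc] using this
      · rintro rfl; simp
    simp only [h]
    ext
    · simp [mul_assoc]
    · simp only [add_assoc, CharTwo.add_self_eq_zero, add_zero]

open Classical in
theorem f_apply (i : B) (t : W) (e : ZMod 2) : f cs i (t, e) =
    (cs.simple i * t * cs.simple i, e + if t = cs.simple i then 1 else 0) := rfl

theorem inv_pow_aux (i j : B) (n : ℕ) :
    cs.simple j * (cs.simple i * cs.simple j) ^ n =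
      ((cs.simple i * cs.simple j) ^ n)⁻¹ * cs.simple j := by
  induction n with
  | zero => simp
  | succ n ih =>
    rw [pow_succ, ← mul_assoc, ih, ← pow_succ, pow_succ', mul_inv_rev]
    simp [mul_assoc]

open Classical in
theorem f_pow (i j : B) (n : ℕ) (t : W) (e : ZMod 2) :
    ((f cs i * f cs j) ^ n) (t, e) =
      ((cs.simple i * cs.simple j) ^ n * t * ((cs.simple i * cs.simple j) ^ n)⁻¹,
        e + ∑ k ∈ Finset.range (2 * n),
          if t = cs.simple j * (cs.simple i * cs.simple j) ^ k then 1 else 0) := by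
  induction n with
  | zero => simp
  | succ n ih =>
    have hi := inv_pow_aux cs i j n
    rw [pow_succ', Equiv.Perm.mul_apply, ih, Equiv.Perm.mul_apply, f_apply, f_apply]
    have e1 : (cs.simple i * cs.simple j) ^ n * t * ((cs.simple i * cs.simple j) ^ n)⁻¹ = cs.simple j
        ↔ t = cs.simple j * (cs.simple i * cs.simple j) ^ (2 * n) := by
      rw [two_mul, pow_add, ← mul_assoc, hi, mul_inv_eq_iff_eq_mul, mul_assoc, eq_inv_mul_iff_mul_eq]
    have e2 : cs.simple j * ((cs.simple i * cs.simple j) ^ n * t *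
        ((cs.simple i * cs.simple j) ^ n)⁻¹) * cs.simple j = cs.simple i
        ↔ t = cs.simple j * (cs.simple i * cs.simple j) ^ (2 * n + 1) := by
      have : cs.simple j * (cs.simple i * cs.simple j) ^ (2 * n + 1) =
        ((cs.simple i * cs.simple j) ^ n)⁻¹ *
          (cs.simple j * cs.simple i * cs.simple j * (cs.simple i * cs.simple j) ^ n) := by
        rw [show 2 * n + 1 = n + (1 + n) by ring, pow_add, ← mul_assoc, hi, pow_add, pow_one]
        simp only [mul_assoc]
      rw [this, eq_inv_mul_iff_mul_eq, ← mul_inv_eq_iff_eq_mul]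
      constructor
      · intro h
        generalize (cs.simple i * cs.simple j) ^ n * t * ((cs.simple i * cs.simple j) ^ n)⁻¹ = y
          at h ⊢
        rw [← h]; simp [mul_assoc]
      · intro h
        rw [h]; simp [mul_assoc]
    simp only [e1, e2]
    rw [show 2 * (n + 1) = 2 * n + 1 + 1 by ring, Finset.sum_range_succ, Finset.sum_range_succ]
    ext
    · simp [mul_assoc, pow_succ']
    · simp only [add_assoc]

theorem f_pow_one (i j : B) (m : ℕ) (hm : (cs.simple i * cs.simple j) ^ m = 1) :
    (f cs i * f cs j) ^ m = 1 := by
  ext1 ⟨t, e⟩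
  have h : ∀ k, (cs.simple i * cs.simple j) ^ (m + k) = (cs.simple i * cs.simple j) ^ k := by
    intro k
    rw [pow_add, hm, one_mul]
  rw [f_pow, hm, two_mul, Finset.sum_range_add, ← Finset.sum_add_distrib,
    Finset.sum_eq_zero (fun k _ => by rw [h k]; exact CharTwo.add_self_eq_zero _)]
  simp

theorem f_liftable : M.IsLiftable (f cs) := fun i j =>
  f_pow_one cs i j _ (cs.simple_mul_simple_pow i j)

noncomputable def phi : W →* Equiv.Perm (W × ZMod 2) := cs.lift ⟨f cs, f_liftable cs⟩

open Classical in
theorem phi_word (ω : List B) (t : W) (e : ZMod 2) :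
    phi cs (cs.wordProd ω) (t, e) = (cs.wordProd ω * t * (cs.wordProd ω)⁻¹,
      e + ((cs.rightInvSeq ω).count t : ZMod 2)) := by
  induction ω with
  | nil => simp
  | cons i ω ih =>
    rw [cs.wordProd_cons, map_mul, Equiv.Perm.mul_apply, ih]
    have : phi cs (cs.simple i) = f cs i := cs.lift_apply_simple (f_liftable cs) i
    rw [this, f_apply]
    have e1 : cs.wordProd ω * t * (cs.wordProd ω)⁻¹ = cs.simple i ↔
      (cs.wordProd ω)⁻¹ * cs.simple i * cs.wordProd ω = t := by
      rw [mul_inv_eq_iff_eq_mul, mul_assoc, inv_mul_eq_iff_eq_mul, eq_comm]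
    simp only [e1, CoxeterSystem.rightInvSeq, List.count_cons]
    ext
    · simp [mul_assoc]
    · simp [add_assoc]

theorem exchange (ω : List B) (i : B)
    (h : cs.length (cs.wordProd ω * cs.simple i) < cs.length (cs.wordProd ω)) :
    cs.simple i ∈ cs.rightInvSeq ω := by
  classical
  obtain ⟨ω', hr, hω'⟩ := cs.exists_isReduced (cs.wordProd ω * cs.simple i)
  have hw : cs.wordProd ω = cs.wordProd (ω' ++ [i]) := by
    rw [cs.wordProd_append, ← hω']; simp
  have hred : cs.IsReduced (ω' ++ [i]) := by
    have h1 := cs.length_mul_simple (cs.wordProd ω) i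
    have h2 : cs.length (cs.wordProd ω') = ω'.length := hr
    rw [← hω'] at h2
    unfold CoxeterSystem.IsReduced
    rw [← hw]
    simp
    omega
  have hmem : cs.simple i ∈ cs.rightInvSeq (ω' ++ [i]) := by
    rw [← List.concat_eq_append, cs.rightInvSeq_concat]; simp
  have hc := List.count_eq_one_of_mem hred.nodup_rightInvSeq hmem
  have a := phi_word cs ω (cs.simple i) 0
  rw [hw, phi_word, hc] at a
  have a2 := congrArg Prod.snd a
  by_contra hn
  rw [List.count_eq_zero_of_not_mem hn] at a2
  simp at a2

theorem key (x : W) (i j : B) (h1 : cs.length x < cs.length (cs.simple i * x))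
    (h2 : cs.length x < cs.length (x * cs.simple j))
    (h3 : cs.length (cs.simple i * x * cs.simple j) < cs.length (cs.simple i * x)) :
    cs.simple i * x = x * cs.simple j := by
  obtain ⟨ω, hr, rfl⟩ := cs.exists_isReduced x
  rw [← cs.wordProd_cons] at h3
  have := exchange cs _ _ h3
  simp only [CoxeterSystem.rightInvSeq, List.mem_cons] at this
  rcases this with h | h
  · rw [h]; simp [mul_assoc]
  · have := (cs.isRightInversion_of_mem_rightInvSeq hr h).2
    omega

open Classical in
noncomputable def L (i : B) : Module.End (LaurentPolynomial ℤ) (W →₀ LaurentPolynomial ℤ) :=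
  Finsupp.linearCombination _ fun x =>
    if cs.length x < cs.length (cs.simple i * x) then heckeStd (cs.simple i * x)
    else (T (-1) - T 1 : LaurentPolynomial ℤ) • heckeStd x + heckeStd (cs.simple i * x)

open Classical in
noncomputable def R (i : B) : Module.End (LaurentPolynomial ℤ) (W →₀ LaurentPolynomial ℤ) :=
  Finsupp.linearCombination _ fun x =>
    if cs.length x < cs.length (x * cs.simple i) then heckeStd (x * cs.simple i)
    else (T (-1) - T 1 : LaurentPolynomial ℤ) • heckeStd x + heckeStd (x * cs.simple i)

theorem L_up {i : B} {x : W} (h : cs.length x < cs.length (cs.simple i * x)) :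
    L cs i (heckeStd x) = heckeStd (cs.simple i * x) := by
  simp [L, heckeStd, h]

theorem L_down {i : B} {x : W} (h : cs.length (cs.simple i * x) < cs.length x) :
    L cs i (heckeStd x) = (T (-1) - T 1 : LaurentPolynomial ℤ) • heckeStd x
      + heckeStd (cs.simple i * x) := by
  unfold L
  conv_lhs => rw [heckeStd, Finsupp.linearCombination_single, if_neg h.not_gt, one_smul]

theorem R_up {i : B} {x : W} (h : cs.length x < cs.length (x * cs.simple i)) :
    R cs i (heckeStd x) = heckeStd (x * cs.simple i) := by
  simp [R, heckeStd, h]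

theorem R_down {i : B} {x : W} (h : cs.length (x * cs.simple i) < cs.length x) :
    R cs i (heckeStd x) = (T (-1) - T 1 : LaurentPolynomial ℤ) • heckeStd x
      + heckeStd (x * cs.simple i) := by
  unfold R
  conv_lhs => rw [heckeStd, Finsupp.linearCombination_single, if_neg h.not_gt, one_smul]

theorem hext {N : Type} [AddCommMonoid N] [Module (LaurentPolynomial ℤ) N]
    {p q : (W →₀ LaurentPolynomial ℤ) →ₗ[LaurentPolynomial ℤ] N}
    (h : ∀ x, p (heckeStd x) = q (heckeStd x)) : p = q :=
  Finsupp.lhom_ext' fun x => LinearMap.ext_ring (h x)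

theorem comm (i j : B) : L cs i * R cs j = R cs j * L cs i := by
  refine hext fun x => ?_
  simp only [Module.End.mul_apply]
  have a1 := cs.length_simple_mul x i
  have a2 := cs.length_mul_simple x j
  have a3 := cs.length_simple_mul (x * cs.simple j) i
  have a4 := cs.length_mul_simple (cs.simple i * x) j
  rw [← mul_assoc] at a3
  rcases lt_or_gt_of_ne (cs.length_simple_mul_ne x i) with h1 | h1 <;>
  rcases lt_or_gt_of_ne (cs.length_mul_simple_ne x j) with h2 | h2
  · rw [L_down cs h1, R_down cs h2]
    simp only [map_add, map_smul]
    rw [L_down cs h1, R_down cs h2]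
    rcases lt_or_gt_of_ne (cs.length_mul_simple_ne (cs.simple i * x) j) with h3 | h3
    · rw [R_down cs h3, L_down cs (by rw [← mul_assoc]; omega)]
      simp only [mul_assoc, smul_add]; abel
    · have hk := key cs (cs.simple i * x) i j (by simpa using h1) h3 (by simpa using h2)
      rw [R_up cs h3, L_up cs (by rw [← mul_assoc]; omega)]
      have hk' : x * cs.simple j = cs.simple i * x := by
        have : x = cs.simple i * x * cs.simple j := by simpa using hk
        conv_lhs => rw [this]
        simp
      rw [hk']
      simp only [mul_assoc, smul_add, hk']
  · rw [L_down cs h1, R_up cs h2]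
    simp only [map_add, map_smul]
    rw [R_up cs h2, R_up cs (by omega), L_down cs (by rw [← mul_assoc]; omega)]
    simp only [mul_assoc]
  · rw [L_up cs h1, R_down cs h2]
    simp only [map_add, map_smul]
    rw [L_up cs h1, R_down cs (by omega), L_up cs (by rw [← mul_assoc]; omega)]
    simp only [mul_assoc]
  · rw [L_up cs h1, R_up cs h2]
    rcases lt_or_gt_of_ne (cs.length_mul_simple_ne (cs.simple i * x) j) with h3 | h3
    · rw [R_down cs h3, L_down cs (by rw [← mul_assoc]; omega), ← mul_assoc,
        key cs x i j h1 h2 h3]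
    · rw [R_up cs h3, L_up cs (by rw [← mul_assoc]; omega), mul_assoc]

noncomputable abbrev A : Subalgebra (LaurentPolynomial ℤ)
    (Module.End (LaurentPolynomial ℤ) (W →₀ LaurentPolynomial ℤ)) :=
  Algebra.adjoin _ (Set.range (L cs))

theorem A_comm (P : Module.End (LaurentPolynomial ℤ) (W →₀ LaurentPolynomial ℤ))
    (hP : P ∈ A cs) (j : B) : P * R cs j = R cs j * P := by
  have : A cs ≤ Subalgebra.centralizer _ {R cs j} := by
    refine Algebra.adjoin_le ?_
    rintro _ ⟨i, rfl⟩
    rw [SetLike.mem_coe, Subalgebra.mem_centralizer_iff]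
    rintro _ rfl
    exact (comm cs i j).symm
  exact ((Subalgebra.mem_centralizer_iff _).1 (this hP) _ rfl).symm

noncomputable def ev : A cs →ₗ[LaurentPolynomial ℤ] (W →₀ LaurentPolynomial ℤ) :=
  (LinearMap.applyₗ (heckeStd (1 : W))).comp (A cs).val.toLinearMap

theorem ev_apply (P : A cs) : ev cs P = P.1 (heckeStd 1) := rfl

theorem ev_inj : Function.Injective (ev cs) := by
  intro P Q h
  rw [ev_apply, ev_apply] at h
  refine Subtype.ext (hext ?_)
  refine right_induction cs h ?_
  intro j x hx ih
  rw [← R_up cs hx, ← Module.End.mul_apply, ← Module.End.mul_apply, A_comm cs _ P.2,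
    A_comm cs _ Q.2, Module.End.mul_apply, Module.End.mul_apply, ih]

theorem ev_surj : Function.Surjective (ev cs) := by
  have h : ∀ x : W, heckeStd x ∈ LinearMap.range (ev cs) := by
    refine left_induction cs ⟨1, rfl⟩ ?_
    rintro i x hx ⟨P, hP⟩
    refine ⟨⟨L cs i, Algebra.subset_adjoin ⟨i, rfl⟩⟩ * P, ?_⟩
    rw [← L_up cs hx, ← hP]; rfl
  rw [← LinearMap.range_eq_top, eq_top_iff]
  intro a _
  rw [← Finsupp.sum_single a]
  refine Submodule.sum_mem _ fun x _ => ?_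
  have := Submodule.smul_mem _ (a x) (h x)
  simpa [heckeStd] using this

noncomputable def E : A cs ≃ₗ[LaurentPolynomial ℤ] (W →₀ LaurentPolynomial ℤ) :=
  LinearEquiv.ofBijective (ev cs) ⟨ev_inj cs, ev_surj cs⟩

theorem E_apply (P : A cs) : E cs P = P.1 (heckeStd 1) := rfl

noncomputable def mul : (W →₀ LaurentPolynomial ℤ) →ₗ[LaurentPolynomial ℤ]
    (W →₀ LaurentPolynomial ℤ) →ₗ[LaurentPolynomial ℤ] (W →₀ LaurentPolynomial ℤ) :=
  (A cs).val.toLinearMap.comp (E cs).symm.toLinearMap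

theorem mul_def (a b : W →₀ LaurentPolynomial ℤ) : mul cs a b = ((E cs).symm a).1 b := rfl

theorem symm_one : (E cs).symm (heckeStd 1) = 1 := by
  rw [LinearEquiv.symm_apply_eq]; rfl

theorem mul_one' (a : W →₀ LaurentPolynomial ℤ) : mul cs a (heckeStd 1) = a := by
  rw [mul_def, ← E_apply, LinearEquiv.apply_symm_apply]

theorem symm_mul (a b : W →₀ LaurentPolynomial ℤ) :
    (E cs).symm (mul cs a b) = (E cs).symm a * (E cs).symm b := by
  rw [LinearEquiv.symm_apply_eq, E_apply]
  change _ = ((E cs).symm a).1 (((E cs).symm b).1 (heckeStd 1))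
  rw [← mul_def, ← mul_def, mul_one']

theorem mul_simple (i : B) (a : W →₀ LaurentPolynomial ℤ) :
    mul cs (heckeStd (cs.simple i)) a = L cs i a := by
  have : (E cs).symm (heckeStd (cs.simple i)) = ⟨L cs i, Algebra.subset_adjoin ⟨i, rfl⟩⟩ := by
    rw [LinearEquiv.symm_apply_eq, E_apply]
    change _ = L cs i _
    rw [L_up cs (by simp)]; simp
  rw [mul_def, this]

end cox
end HeckeAux

/-- **Existence and uniqueness of the Hecke algebra multiplication.** On the free
`ℤ[v,v⁻¹]`-module with basis `(h_x)_{x ∈ W}` there is exactly one associative,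
`ℤ[v,v⁻¹]`-bilinear multiplication with unit `h_e` such that for all `s ∈ S` and
`x ∈ W`: `h_s h_x = h_{sx}` if `ℓ(sx) > ℓ(x)`, and `h_s h_x = (v⁻¹ − v) h_x + h_{sx}`
if `ℓ(sx) < ℓ(x)` (here `v := T 1`). -/
theorem hecke_multiplication_exists_unique
    {B W : Type} [Group W] {M : CoxeterMatrix B} (cs : CoxeterSystem M W) :
    ∃! mul : (W →₀ LaurentPolynomial ℤ) →ₗ[LaurentPolynomial ℤ]
        (W →₀ LaurentPolynomial ℤ) →ₗ[LaurentPolynomial ℤ] (W →₀ LaurentPolynomial ℤ),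
      (∀ a b c : W →₀ LaurentPolynomial ℤ, mul (mul a b) c = mul a (mul b c)) ∧
      (∀ a : W →₀ LaurentPolynomial ℤ, mul (heckeStd 1) a = a ∧ mul a (heckeStd 1) = a) ∧
      ∀ (i : B) (x : W),
        (cs.length (cs.simple i * x) > cs.length x →
          mul (heckeStd (cs.simple i)) (heckeStd x) = heckeStd (cs.simple i * x)) ∧
        (cs.length (cs.simple i * x) < cs.length x →
          mul (heckeStd (cs.simple i)) (heckeStd x) =
            (T (-1) - T 1 : LaurentPolynomial ℤ) • heckeStd x + heckeStd (cs.simple i * x)) := by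
  open HeckeAux in
  refine ⟨HeckeAux.mul cs, ⟨?_, ?_, ?_⟩, ?_⟩
  · intro a b c
    rw [mul_def, symm_mul]; rfl
  · intro a
    exact ⟨by rw [mul_def, symm_one]; rfl, mul_one' cs a⟩
  · intro i x
    exact ⟨fun h => by rw [mul_simple, L_up cs h], fun h => by rw [mul_simple, L_down cs h]⟩
  · rintro m ⟨hassoc, hone, hs⟩
    have hL : ∀ i, m (heckeStd (cs.simple i)) = L cs i := by
      intro i
      refine hext fun x => ?_
      rcases lt_or_gt_of_ne (cs.length_simple_mul_ne x i) with h | h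
      · rw [(hs i x).2 h, L_down cs h]
      · rw [(hs i x).1 h, L_up cs h]
    refine hext ?_
    refine left_induction cs ?_ ?_
    · refine LinearMap.ext fun a => ?_
      rw [(hone a).1, mul_def, symm_one]; rfl
    · intro i x hx ih
      refine LinearMap.ext fun a => ?_
      rw [← (hs i x).1 hx, hassoc, (hs i x).1 hx, ← L_up cs hx, ← mul_simple, hL, ih,
        ← mul_simple]
      rw [mul_def cs (HeckeAux.mul cs _ _) a, symm_mul]; rfl
end

section
/- If γ is a self-adjoint degree-2 endomorphism satisfying the Hodge–Riemann bilinear relations, then γ satisfies hard Lefschetz. -/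
/-- `γ : V → V` is a degree-2 map with respect to the grading `H`: it sends `H^i` into
`H^{i+2}` for every `i`. -/
def IsDegTwo {V : Type} [AddCommGroup V] [Module ℝ V]
    (H : ℤ → Submodule ℝ V) (γ : V → V) : Prop :=
  ∀ i : ℤ, ∀ x ∈ H i, γ x ∈ H (i + 2)

/-- `γ` satisfies hard Lefschetz with respect to the grading `H`: for every `i ≥ 0` the
`i`-fold composite `γ^i` restricts to a linear isomorphism `H^{-i} → H^i` (expressed as:
every `y ∈ H^i` has a unique preimage in `H^{-i}` under `γ^i`). -/
def HardLefschetz {V : Type} [AddCommGroup V] [Module ℝ V]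
    (H : ℤ → Submodule ℝ V) (γ : V → V) : Prop :=
  ∀ i : ℕ, ∀ y ∈ H (i : ℤ), ∃! x, x ∈ H (-(i : ℤ)) ∧ γ^[i] x = y

/-- `B` is a Lefschetz form on the graded vector space `H`: a nondegenerate symmetric
bilinear form with `⟨H^i, H^j⟩ = 0` whenever `i + j ≠ 0`. -/
def IsLefschetzForm {V : Type} [AddCommGroup V] [Module ℝ V]
    (H : ℤ → Submodule ℝ V) (B : V →ₗ[ℝ] V →ₗ[ℝ] ℝ) : Prop :=
  (∀ x y : V, B x y = B y x) ∧
  (∀ x : V, (∀ y : V, B x y = 0) → x = 0) ∧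
  ∀ i j : ℤ, i + j ≠ 0 → ∀ x ∈ H i, ∀ y ∈ H j, B x y = 0


/-- `γ` satisfies the Hodge–Riemann bilinear relations with respect to the Lefschetz form
`B` and minimal degree `m`: for every `i ≥ 0` with `H^{-i} ≠ 0`, the restriction of
`(h, h')_γ^{-i} := ⟨h, γ^i h'⟩` to the primitive subspace
`P_γ^{-i} := ker(γ^{i+1}) ∩ H^{-i}` is positive definite if `(−i−m)/2` is even and
negative definite if `(−i−m)/2` is odd. -/
def HodgeRiemann {V : Type} [AddCommGroup V] [Module ℝ V]
    (H : ℤ → Submodule ℝ V) (B : V →ₗ[ℝ] V →ₗ[ℝ] ℝ) (m : ℤ) (γ : V →ₗ[ℝ] V) : Prop :=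
  ∀ i : ℕ, H (-(i : ℤ)) ≠ ⊥ →
    (Even ((-(i : ℤ) - m) / 2) →
      ∀ x ∈ H (-(i : ℤ)), (γ ^ (i + 1)) x = 0 → x ≠ 0 → 0 < B x ((γ ^ i) x)) ∧
    (¬ Even ((-(i : ℤ) - m) / 2) →
      ∀ x ∈ H (-(i : ℤ)), (γ ^ (i + 1)) x = 0 → x ≠ 0 → B x ((γ ^ i) x) < 0)

/-- **Hodge–Riemann implies hard Lefschetz.** Let `H` be a nonzero finite-dimensional
graded real vector space concentrated in degrees congruent to the minimal degree `m`
modulo 2, with a Lefschetz form `B`. If `γ` is a self-adjoint degree-2 endomorphism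
satisfying the Hodge–Riemann bilinear relations, then `γ` satisfies hard Lefschetz. -/
theorem hodgeRiemann_implies_hardLefschetz
    {V : Type} [AddCommGroup V] [Module ℝ V] [FiniteDimensional ℝ V]
    (H : ℤ → Submodule ℝ V) (hint : DirectSum.IsInternal H)
    (m : ℤ) (hm : H m ≠ ⊥) (hmin : ∀ j : ℤ, j < m → H j = ⊥)
    (hpar : ∀ i : ℤ, ¬ Even (i - m) → H i = ⊥)
    (B : V →ₗ[ℝ] V →ₗ[ℝ] ℝ) (hB : IsLefschetzForm H B)
    (γ : V →ₗ[ℝ] V) (hγ : IsDegTwo H ⇑γ)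
    (hsa : ∀ x y : V, B (γ x) y = B x (γ y))
    (hHR : HodgeRiemann H B m γ) :
    HardLefschetz H ⇑γ := by
  obtain ⟨_, hnd, horth⟩ := hB
  have hpow : ∀ (n : ℕ) (j : ℤ), ∀ x ∈ H j, (γ ^ n) x ∈ H (j + 2 * n) := by
    intro n
    induction n with
    | zero => intro j x hx; simpa using hx
    | succ n ih =>
      intro j x hx
      have h := hγ _ _ (ih j x hx)
      rw [pow_succ', Module.End.mul_apply]
      convert h using 2
      push_cast
      ring
  intro i y hy
  have hinj : ∀ x ∈ H (-(i : ℤ)), (γ ^ i) x = 0 → x = 0 := by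
    intro x hx h0
    by_contra hne
    have hbot : H (-(i : ℤ)) ≠ ⊥ := by
      intro hb
      rw [hb] at hx
      exact hne ((Submodule.mem_bot ℝ).1 hx)
    have h1 : (γ ^ (i + 1)) x = 0 := by
      rw [pow_succ', Module.End.mul_apply, h0, map_zero]
    have h2 := hHR i hbot
    by_cases he : Even ((-(i : ℤ) - m) / 2)
    · have := h2.1 he x hx h1 hne
      simp [h0] at this
    · have := h2.2 he x hx h1 hne
      simp [h0] at this
  have hmap : ∀ x ∈ H (-(i : ℤ)), (γ ^ i) x ∈ H (i : ℤ) := by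
    intro x hx
    have h := hpow i _ x hx
    convert h using 2
    ring
  let f : H (-(i : ℤ)) →ₗ[ℝ] H (i : ℤ) := (γ ^ i).restrict hmap
  have hf : Function.Injective f := by
    rw [injective_iff_map_eq_zero]
    rintro ⟨x, hx⟩ h
    have h' := congrArg Subtype.val h
    exact Subtype.ext (hinj x hx h')
  let g : H (i : ℤ) →ₗ[ℝ] Module.Dual ℝ (H (-(i : ℤ))) :=
    (LinearMap.lcomp ℝ ℝ (H (-(i : ℤ))).subtype) ∘ₗ B ∘ₗ (H (i : ℤ)).subtype
  have hg : Function.Injective g := by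
    rw [injective_iff_map_eq_zero]
    rintro ⟨x, hx⟩ h
    refine Subtype.ext (hnd x ?_)
    have hle : (⨆ j, H j) ≤ LinearMap.ker (B x) := by
      refine iSup_le fun j z hz => ?_
      rw [LinearMap.mem_ker]
      by_cases hj : (i : ℤ) + j = 0
      · have hj' : j = -(i : ℤ) := by omega
        subst hj'
        exact LinearMap.congr_fun h ⟨z, hz⟩
      · exact horth _ _ hj x hx z hz
    intro z
    have hz : z ∈ ⨆ j, H j := by
      rw [hint.submodule_iSup_eq_top]; trivial
    exact LinearMap.mem_ker.1 (hle hz)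
  have hd1 := LinearMap.finrank_le_finrank_of_injective hf
  have hd2 := LinearMap.finrank_le_finrank_of_injective hg
  rw [Subspace.dual_finrank_eq] at hd2
  have hsurj : Function.Surjective f :=
    (LinearMap.injective_iff_surjective_of_finrank_eq_finrank (le_antisymm hd1 hd2)).1 hf
  obtain ⟨⟨x, hx⟩, hxy⟩ := hsurj ⟨y, hy⟩
  have hxy' : (γ ^ i) x = y := congrArg Subtype.val hxy
  refine ⟨x, ⟨hx, by rw [← Module.End.pow_apply]; exact hxy'⟩, ?_⟩
  rintro x' ⟨hx', h'⟩
  rw [← Module.End.pow_apply] at h'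
  refine sub_eq_zero.1 (hinj _ (Submodule.sub_mem _ hx' hx) ?_)
  rw [map_sub, h', hxy', sub_self]
end

section
/- There exists a unique group homomorphism ρ : W → GL(𝔥) such that for every s ∈ S and v ∈ 𝔥, ρ(s)(v) = v − ⟨α_s, v⟩ α_s^∨. In particular each ρ(s) is a reflection (an involution fixing the hyperplane ker α_s and sending α_s^∨ to −α_s^∨). -/
open Polynomial.Chebyshev in
theorem refl_pow_aux {V : Type} [AddCommGroup V] [Module ℝ V] {x y : V} {f g : Module.Dual ℝ V}
    (hf : f x = 2) (hg : g y = 2) (m : ℕ) (hm : 2 ≤ m)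
    (h1 : f y = -2 * Real.cos (Real.pi / (m : ℝ))) (h2 : g x = -2 * Real.cos (Real.pi / (m : ℝ))) :
    (Module.reflection hf * Module.reflection hg) ^ m = 1 := by
  rcases eq_or_lt_of_le hm with rfl | hm3
  · have e1 : f y = 0 := by rw [h1]; simp
    have e2 : g x = 0 := by rw [h2]; simp
    ext z
    simp only [pow_two, LinearEquiv.mul_apply, Module.reflection_apply, map_sub, map_smul, hf, hg,
      e1, e2, LinearEquiv.coe_one, id]
    module
  have hm0 : (0 : ℝ) < m := by positivity
  set φ : ℝ := 2 * (Real.pi / m) with hφ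
  have hmφ : (m : ℝ) * φ = 2 * Real.pi := by rw [hφ]; field_simp
  have ht : 2 * Real.cos φ = f y * g x - 2 := by
    rw [h1, h2, hφ, Real.cos_two_mul]; ring
  have hsin : Real.sin φ ≠ 0 := by
    have h3 : (3 : ℝ) ≤ m := by exact_mod_cast hm3
    have hpi := Real.pi_pos
    apply ne_of_gt
    apply Real.sin_pos_of_pos_of_lt_pi
    · positivity
    · by_contra hc
      push Not at hc
      nlinarith
  have hS : ∀ n : ℤ, (S ℝ n).eval (2 * Real.cos φ) = Real.sin ((n + 1) * φ) / Real.sin φ := by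
    intro n
    rw [eq_div_iff hsin]
    exact S_two_mul_real_cos φ n
  ext z
  rw [Module.reflection_mul_reflection_pow_apply hf hg m z _ ht]
  obtain ⟨k, hk | hk⟩ : ∃ k : ℕ, m = 2 * k ∨ m = 2 * k + 1 := ⟨m / 2, by omega⟩
  · have a1 : ((m : ℤ) - 2) / 2 = k - 1 := by omega
    have a2 : ((m : ℤ) - 1) / 2 = k - 1 := by omega
    have hz : (S ℝ ((k : ℤ) - 1)).eval (2 * Real.cos φ) = 0 := by
      rw [hS]
      have : (((k : ℤ) - 1 : ℤ) + 1 : ℝ) * φ = Real.pi := by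
        rw [hk] at hmφ
        push_cast at hmφ ⊢
        linarith
      rw [this]; simp
    rw [a1, a2, hz]
    simp
  · have a1 : ((m : ℤ) - 1) / 2 = k := by omega
    have a2 : ((m : ℤ) - 3) / 2 = k - 1 := by omega
    have a3 : (m : ℤ) / 2 = k := by omega
    have a4 : ((m : ℤ) - 2) / 2 = k - 1 := by omega
    have hz : (S ℝ (k : ℤ)).eval (2 * Real.cos φ) + (S ℝ ((k : ℤ) - 1)).eval (2 * Real.cos φ)
        = 0 := by
      rw [hS, hS, ← add_div]
      have : (((k : ℤ) : ℝ) + 1) * φ = 2 * Real.pi - (((k : ℤ) - 1 : ℤ) + 1 : ℝ) * φ := by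
        rw [hk] at hmφ
        push_cast at hmφ ⊢
        linarith
      rw [this, Real.sin_two_pi_sub]; simp
    rw [a1, a2, a3, a4, hz]
    simp

/-- **Existence and uniqueness of the reflection representation.** Let `(W, S)` be a
Coxeter system with finite `S` and Coxeter matrix `(m_{st})` (where `m_{st} = 0` encodes
`m_{st} = ∞`), let `𝔥` be a finite-dimensional real vector space with linearly
independent families of coroots `(α_s^∨) ⊆ 𝔥` and roots `(α_s) ⊆ 𝔥*` satisfying
`⟨α_s, α_t^∨⟩ = −2 cos(π / m_{st})` (with value `−2` when `m_{st} = ∞`). Then there is a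
unique group homomorphism `ρ : W → GL(𝔥)` with
`ρ(s)(v) = v − ⟨α_s, v⟩ α_s^∨` for all `s ∈ S`, `v ∈ 𝔥`; in particular each `ρ(s)` is a
reflection: an involution fixing the hyperplane `ker α_s` and sending `α_s^∨` to
`−α_s^∨`. -/
theorem reflection_representation_exists_unique
    {B W : Type} [Group W] [Fintype B] {M : CoxeterMatrix B} (cs : CoxeterSystem M W)
    {V : Type} [AddCommGroup V] [Module ℝ V] [FiniteDimensional ℝ V]
    (coroot : B → V) (root : B → Module.Dual ℝ V)
    (hcoroot : LinearIndependent ℝ coroot) (hroot : LinearIndependent ℝ root)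
    (hpair : ∀ s t : B, root s (coroot t) =
      (if M s t = 0 then -2 else -2 * Real.cos (Real.pi / (M s t : ℝ)))) :
    (∃! ρ : W →* (V →ₗ[ℝ] V)ˣ,
      ∀ (s : B) (v : V), (ρ (cs.simple s) : V →ₗ[ℝ] V) v = v - (root s v) • coroot s) ∧
    ∀ ρ : W →* (V →ₗ[ℝ] V)ˣ,
      (∀ (s : B) (v : V), (ρ (cs.simple s) : V →ₗ[ℝ] V) v = v - (root s v) • coroot s) →
      ∀ s : B,
        ρ (cs.simple s) * ρ (cs.simple s) = 1 ∧
        (∀ v : V, root s v = 0 → (ρ (cs.simple s) : V →ₗ[ℝ] V) v = v) ∧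
        (ρ (cs.simple s) : V →ₗ[ℝ] V) (coroot s) = - coroot s := by
  classical
  have h2 : ∀ s, root s (coroot s) = 2 := by
    intro s
    rw [hpair, M.diagonal]
    simp
  refine ⟨?_, ?_⟩
  · have hl : M.IsLiftable (fun s => Module.reflection (h2 s)) := by
      intro s t
      by_cases hst : s = t
      · subst hst
        rw [M.diagonal, pow_one]
        ext v
        exact Module.involutive_reflection (h2 s) v
      by_cases h0 : M s t = 0
      · rw [h0, pow_zero]
      have h1 := M.off_diagonal s t hst
      have p1 := hpair s t
      have p2 := hpair t s
      rw [M.symmetric t s] at p2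
      rw [if_neg h0] at p1 p2
      exact refl_pow_aux _ _ _ (by omega) p1 p2
    refine ⟨(LinearMap.GeneralLinearGroup.generalLinearEquiv ℝ V).symm.toMonoidHom.comp
      (cs.lift ⟨_, hl⟩), ?_, ?_⟩
    · intro s v
      simp only [MonoidHom.comp_apply, cs.lift_apply_simple hl]
      exact Module.reflection_apply v (h2 s)
    · intro ρ hρ
      apply cs.ext_simple
      intro s
      ext v
      rw [hρ]
      simp only [MonoidHom.comp_apply, cs.lift_apply_simple hl]
      exact (Module.reflection_apply v (h2 s)).symm
  · intro ρ hρ s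
    refine ⟨?_, ?_, ?_⟩
    · rw [← map_mul, cs.simple_mul_simple_self, map_one]
    · intro v hv
      rw [hρ, hv]; simp
    · rw [hρ, h2]; module
end

section
/- There is an isomorphism of (R,R)-bimodules R ⊗_A R ⊗_A R ≅ (R ⊗_A R) ⊕ (R ⊗_A R), where the left R-action is on the leftmost tensor factor and the right R-action on the rightmost. (This is the decomposition B_s B_s ≅ B_s(1) ⊕ B_s(−1) of Soergel bimodules in rank one, categorifying b_s b_s = (v + v⁻¹) b_s in the Hecke algebra.) -/
open TensorProduct

noncomputable section

/-- The subalgebra `A = ℝ[X²] ⊆ R = ℝ[X]` of polynomials invariant under `X ↦ −X`. -/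
def evenSub : Subalgebra ℝ (Polynomial ℝ) := Algebra.adjoin ℝ {(Polynomial.X : Polynomial ℝ) ^ 2}

/-- Right multiplication by `c ∈ R` on the rightmost factor of `R ⊗_A R`. -/
def rmulTwo (c : Polynomial ℝ) :
    Polynomial ℝ ⊗[evenSub] Polynomial ℝ →ₗ[evenSub] Polynomial ℝ ⊗[evenSub] Polynomial ℝ :=
  LinearMap.lTensor (Polynomial ℝ) (LinearMap.mulRight evenSub c)

/-- Right multiplication by `c ∈ R` on the rightmost factor of `R ⊗_A R ⊗_A R`. -/
def rmulThree (c : Polynomial ℝ) :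
    Polynomial ℝ ⊗[evenSub] (Polynomial ℝ ⊗[evenSub] Polynomial ℝ) →ₗ[evenSub]
      Polynomial ℝ ⊗[evenSub] (Polynomial ℝ ⊗[evenSub] Polynomial ℝ) :=
  LinearMap.lTensor (Polynomial ℝ) (rmulTwo c)

theorem even_comp (a : Polynomial ℝ) (ha : a ∈ evenSub) : a.comp (-Polynomial.X) = a := by
  unfold evenSub at ha
  induction ha using Algebra.adjoin_induction with
  | mem x hx => rw [Set.mem_singleton_iff] at hx; subst hx; simp
  | algebraMap r => simp [Polynomial.algebraMap_eq]
  | add x y _ _ hx hy => rw [Polynomial.add_comp, hx, hy]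
  | mul x y _ _ hx hy => rw [Polynomial.mul_comp, hx, hy]

/-- The map `(a, b) ↦ a + b X`. -/
def psiMap : (evenSub × evenSub) →ₗ[evenSub] Polynomial ℝ :=
  LinearMap.coprod (LinearMap.toSpanSingleton evenSub (Polynomial ℝ) 1)
    (LinearMap.toSpanSingleton evenSub (Polynomial ℝ) Polynomial.X)

theorem psiMap_apply (a b : evenSub) :
    psiMap (a, b) = (a : Polynomial ℝ) + (b : Polynomial ℝ) * Polynomial.X := by
  simp [psiMap, Subalgebra.smul_def]

theorem X_sq_mem : (Polynomial.X : Polynomial ℝ) ^ 2 ∈ evenSub :=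
  Algebra.subset_adjoin (Set.mem_singleton _)

theorem psiMap_bij : Function.Bijective psiMap := by
  constructor
  · rw [injective_iff_map_eq_zero]
    rintro ⟨a, b⟩ h
    rw [psiMap_apply] at h
    have h2 := congrArg (fun p : Polynomial ℝ => p.comp (-Polynomial.X)) h
    simp only [Polynomial.add_comp, Polynomial.mul_comp, Polynomial.X_comp,
      Polynomial.zero_comp, even_comp _ a.2, even_comp _ b.2] at h2
    have ha : (2 : Polynomial ℝ) * (a : Polynomial ℝ) = 0 := by linear_combination h + h2
    have ha' : (a : Polynomial ℝ) = 0 := by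
      rcases mul_eq_zero.mp ha with h0 | h0
      · exact absurd h0 two_ne_zero
      · exact h0
    have hb : (b : Polynomial ℝ) = 0 := by
      rw [ha', zero_add] at h
      rcases mul_eq_zero.mp h with h0 | h0
      · exact h0
      · exact absurd h0 Polynomial.X_ne_zero
    ext1
    · exact Subtype.ext ha'
    · exact Subtype.ext hb
  · intro p
    induction p using Polynomial.induction_on' with
    | add p q hp hq =>
      obtain ⟨u, hu⟩ := hp
      obtain ⟨v, hv⟩ := hq
      exact ⟨u + v, by rw [map_add, hu, hv]⟩
    | monomial n r =>
      have key : ∀ k : ℕ, Polynomial.C r * (Polynomial.X ^ 2) ^ k ∈ evenSub := fun k =>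
        evenSub.mul_mem (evenSub.algebraMap_mem r) (evenSub.pow_mem X_sq_mem k)
      rcases Nat.even_or_odd' n with ⟨k, hk | hk⟩
      · refine ⟨(⟨_, key k⟩, 0), ?_⟩
        rw [psiMap_apply, ← Polynomial.C_mul_X_pow_eq_monomial, hk]
        simp [pow_mul]
      · refine ⟨(0, ⟨_, key k⟩), ?_⟩
        rw [psiMap_apply, ← Polynomial.C_mul_X_pow_eq_monomial, hk]
        simp [pow_mul, pow_succ, mul_assoc]

/-- `R ≃ A × A`. -/
def phiEquiv : Polynomial ℝ ≃ₗ[evenSub] (evenSub × evenSub) :=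
  (LinearEquiv.ofBijective psiMap psiMap_bij).symm

/-- `R ⊗ R ≃ R × R`. -/
def gEquiv : Polynomial ℝ ⊗[evenSub] Polynomial ℝ ≃ₗ[evenSub] Polynomial ℝ × Polynomial ℝ :=
  TensorProduct.congr phiEquiv (LinearEquiv.refl evenSub (Polynomial ℝ)) ≪≫ₗ
    TensorProduct.prodLeft evenSub evenSub evenSub evenSub (Polynomial ℝ) ≪≫ₗ
    LinearEquiv.prodCongr (TensorProduct.lid evenSub (Polynomial ℝ))
      (TensorProduct.lid evenSub (Polynomial ℝ))

theorem gEquiv_tmul (x y : Polynomial ℝ) :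
    gEquiv (x ⊗ₜ y) = ((phiEquiv x).1 • y, (phiEquiv x).2 • y) := by
  rfl

theorem rmulTwo_tmul (c x y : Polynomial ℝ) : rmulTwo c (x ⊗ₜ y) = x ⊗ₜ (y * c) := rfl

theorem rmulThree_tmul (c x : Polynomial ℝ) (y : Polynomial ℝ ⊗[evenSub] Polynomial ℝ) :
    rmulThree c (x ⊗ₜ y) = x ⊗ₜ (rmulTwo c y) := rfl

theorem gEquiv_rmul (c : Polynomial ℝ) (t : Polynomial ℝ ⊗[evenSub] Polynomial ℝ) :
    gEquiv (rmulTwo c t) = ((gEquiv t).1 * c, (gEquiv t).2 * c) := by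
  induction t using TensorProduct.induction_on with
  | zero => rw [map_zero, map_zero]; simp only [Prod.fst_zero, Prod.snd_zero, zero_mul]; rfl
  | tmul x y =>
    rw [rmulTwo_tmul, gEquiv_tmul, gEquiv_tmul]
    simp only [smul_mul_assoc]
  | add x y hx hy => simp only [map_add, hx, hy, Prod.fst_add, Prod.snd_add, add_mul, Prod.mk_add_mk]

/-- The bimodule isomorphism. -/
def eEquiv : (Polynomial ℝ ⊗[evenSub] (Polynomial ℝ ⊗[evenSub] Polynomial ℝ)) ≃ₗ[Polynomial ℝ]
        (Polynomial ℝ ⊗[evenSub] Polynomial ℝ) × (Polynomial ℝ ⊗[evenSub] Polynomial ℝ) :=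
  TensorProduct.AlgebraTensorModule.congr
      (LinearEquiv.refl (Polynomial ℝ) (Polynomial ℝ)) gEquiv ≪≫ₗ
    TensorProduct.prodRight evenSub (Polynomial ℝ) (Polynomial ℝ) (Polynomial ℝ)
      (Polynomial ℝ)

theorem eEquiv_tmul (x : Polynomial ℝ) (y : Polynomial ℝ ⊗[evenSub] Polynomial ℝ) :
    eEquiv (x ⊗ₜ y) = (x ⊗ₜ (gEquiv y).1, x ⊗ₜ (gEquiv y).2) := rfl

/-- **The rank-one decomposition of Soergel bimodules** (categorifying
`b_s b_s = (v + v⁻¹) b_s`): with `R = ℝ[X]` and `A = ℝ[X²]`, there is an isomorphism of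
`(R,R)`-bimodules `R ⊗_A R ⊗_A R ≅ (R ⊗_A R) ⊕ (R ⊗_A R)`, i.e. a left `R`-linear
equivalence commuting with right multiplication by every `c ∈ R` on the rightmost
factor. -/
theorem bimodule_BsBs_iso_Bs_oplus_Bs :
    ∃ e : (Polynomial ℝ ⊗[evenSub] (Polynomial ℝ ⊗[evenSub] Polynomial ℝ)) ≃ₗ[Polynomial ℝ]
        (Polynomial ℝ ⊗[evenSub] Polynomial ℝ) × (Polynomial ℝ ⊗[evenSub] Polynomial ℝ),
      ∀ (c : Polynomial ℝ) (t : Polynomial ℝ ⊗[evenSub] (Polynomial ℝ ⊗[evenSub] Polynomial ℝ)),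
        e (rmulThree c t) = (rmulTwo c (e t).1, rmulTwo c (e t).2) := by
  refine ⟨eEquiv, fun c t => ?_⟩
  induction t using TensorProduct.induction_on with
  | zero =>
    rw [map_zero, eEquiv.map_zero]
    simp only [Prod.fst_zero, Prod.snd_zero]
    rw [map_zero]; rfl
  | tmul x y =>
    rw [rmulThree_tmul, eEquiv_tmul, eEquiv_tmul, gEquiv_rmul, rmulTwo_tmul, rmulTwo_tmul]
  | add x y hx hy =>
    rw [map_add, eEquiv.map_add, hx, hy, eEquiv.map_add, Prod.fst_add, Prod.snd_add, map_add,
      map_add, Prod.mk_add_mk]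

end
end
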